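/- arXiv:1209.1850 — 3 statements merged into one kernel-verified Lean document; each statement's English description precedes it below -/
import Mathlib

section
/- Let a ∈ 𝒮(ℝ²ⁿ) be a Schwartz function and Ψ ∈ 𝒮(ℝ²ⁿ). Then for all (x,p) ∈ ℝⁿ × ℝⁿ: (2π)^{-n} ∫_{ℝⁿ×ℝⁿ} F_σa(x₀, ξ₀) · e^{i(ξ₀·x − (1/2)ξ₀·x₀)} Ψ(x − x₀, p) dx₀ dξ₀ = (2π)^{-n} ∫_{ℝⁿ} ∫_{ℝⁿ} e^{iξ·(x − y)} a((x+y)/2, ξ) Ψ(y, p) dξ dy. In other words, the phase-space Weyl operator Â^W with symbol a acts as the standard Weyl operator â^W in the x-variable and as the identity in the p-variable: Â^W Ψ(x,p) = (â^W Ψ(·,p))(x). -/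
open MeasureTheory Complex ComplexConjugate ENNReal

noncomputable section

/-- Configuration space ℝⁿ. -/
abbrev Cfg (n : ℕ) := Fin n → ℝ

/-- Phase space ℝ²ⁿ = ℝⁿ × ℝⁿ. -/
abbrev Phase (n : ℕ) := (Fin n → ℝ) × (Fin n → ℝ)

/-- Euclidean dot product on ℝⁿ. -/
def dotp (n : ℕ) (a b : Cfg n) : ℝ := ∑ i, a i * b i

/-- The symplectic Fourier transform
F_σa(x₀,ξ₀) = (2π)^{-n} ∫ a(x,ξ) e^{i(x₀·ξ − ξ₀·x)} dx dξ. -/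
def Fsig (n : ℕ) (a : Phase n → ℂ) : Phase n → ℂ :=
  fun z₀ => (((2 * Real.pi) ^ n : ℝ) : ℂ)⁻¹ *
    ∫ z : Phase n, a z *
      Complex.exp (Complex.I * ((dotp n z₀.1 z.2 - dotp n z₀.2 z.1 : ℝ) : ℂ))

open FourierTransform

/-- Phase space identified with the Euclidean space of the same dimension. -/
def phaseEquiv (n : ℕ) : EuclideanSpace ℝ (Fin n ⊕ Fin n) ≃L[ℝ] Phase n :=
  (PiLp.continuousLinearEquiv 2 ℝ _).trans (ContinuousLinearEquiv.sumPiEquivProdPi ℝ _ _ _)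

lemma continuous_dotp {X : Type*} [TopologicalSpace X] {n : ℕ} {f g : X → Cfg n}
    (hf : Continuous f) (hg : Continuous g) : Continuous fun x => dotp n (f x) (g x) := by
  unfold dotp
  fun_prop

lemma dotp_comm (n : ℕ) (u v : Cfg n) : dotp n u v = dotp n v u :=
  dotProduct_comm u v

lemma dotp_sub (n : ℕ) (u v w : Cfg n) : dotp n u (v - w) = dotp n u v - dotp n u w :=
  dotProduct_sub u v w

lemma dotp_smul (n : ℕ) (c : ℝ) (u v : Cfg n) : dotp n u (c • v) = c * dotp n u v :=
  dotProduct_smul c u v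

lemma norm_exp_I_mul (t : ℝ) : ‖Complex.exp (Complex.I * (t : ℂ))‖ = 1 := by
  rw [mul_comm, Complex.norm_exp_ofReal_mul_I]

lemma phaseEquiv_measurePreserving (n : ℕ) :
    MeasurePreserving (phaseEquiv n) volume volume :=
  (volume_measurePreserving_sumPiEquivProdPi (fun _ : Fin n ⊕ Fin n => ℝ)).comp
    (PiLp.volume_preserving_ofLp (Fin n ⊕ Fin n))

lemma inner_phaseEquiv_symm (n : ℕ) (v : EuclideanSpace ℝ (Fin n ⊕ Fin n)) (z : Phase n) :
    inner ℝ v ((phaseEquiv n).symm z) =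
      dotp n (phaseEquiv n v).1 z.1 + dotp n (phaseEquiv n v).2 z.2 := by
  simp only [PiLp.inner_apply, Fintype.sum_sum_type, dotp]
  congr 1 <;> exact Finset.sum_congr rfl fun i _ => mul_comm _ _

/-- The symplectic Fourier transform in terms of the Fourier transform on Euclidean space. -/
lemma Fsig_eq_fourier (n : ℕ) (a : Phase n → ℂ) (z₀ : Phase n) :
    Fsig n a z₀ = (((2 * Real.pi) ^ n : ℝ) : ℂ)⁻¹ *
      𝓕 (a ∘ phaseEquiv n) ((phaseEquiv n).symm ((2 * Real.pi)⁻¹ • (z₀.2, -z₀.1))) := by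
  rw [Fsig, Real.fourier_eq', ← (phaseEquiv_measurePreserving n).integral_comp
    (phaseEquiv n).toHomeomorph.measurableEmbedding]
  congr 2
  ext v
  rw [inner_phaseEquiv_symm, smul_eq_mul, mul_comm, Function.comp_apply]
  congr 2
  rw [mul_comm]
  congr 2
  have h : dotp n (phaseEquiv n v).2 (-z₀.1) = -dotp n (phaseEquiv n v).2 z₀.1 :=
    dotProduct_neg _ _
  simp only [Prod.smul_mk, dotp_smul, h]
  rw [dotp_comm n z₀.1, dotp_comm n z₀.2]
  field_simp
  ring

instance isAddHaarMeasure_volume_phase (n : ℕ) :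
    (volume : Measure (Phase n)).IsAddHaarMeasure :=
  Measure.prod.instIsAddHaarMeasure _ _

lemma integrable_Fsig (n : ℕ) (a : SchwartzMap (Phase n) ℂ) : Integrable (Fsig n a) := by
  let g : SchwartzMap (Phase n) ℂ :=
    SchwartzMap.compCLMOfContinuousLinearEquiv ℂ (phaseEquiv n).symm
      (𝓕 (SchwartzMap.compCLMOfContinuousLinearEquiv ℂ (phaseEquiv n) a))
  have hg : Integrable (fun z : Phase n => g ((2 * Real.pi)⁻¹ • z)) :=
    (integrable_comp_smul_iff volume g (by positivity)).2 g.integrable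
  have hm : MeasurePreserving (fun z : Phase n => (z.2, -z.1)) volume volume :=
    ((MeasurePreserving.id (volume : Measure (Cfg n))).prod
      (Measure.measurePreserving_neg (volume : Measure (Cfg n)))).comp
        Measure.measurePreserving_swap
  have := (hm.integrable_comp_of_integrable hg).const_mul (((2 * Real.pi) ^ n : ℝ) : ℂ)⁻¹
  refine this.congr (.of_forall fun z => ?_)
  rw [Fsig_eq_fourier]
  simp only [Function.comp_apply, g, SchwartzMap.compCLMOfContinuousLinearEquiv_apply,
    SchwartzMap.fourier_coe]

/-- Fourier inversion on `ℝⁿ` with unnormalised frequency. -/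
lemma fourier_inversion_dotp (n : ℕ) {A : Cfg n → ℂ} (hc : Continuous A) (hA : Integrable A)
    (hB : Integrable fun ξ : Cfg n =>
      ∫ x, A x * Complex.exp (Complex.I * ((-dotp n ξ x : ℝ) : ℂ))) (w : Cfg n) :
    ∫ ξ : Cfg n, (∫ x, A x * Complex.exp (Complex.I * ((-dotp n ξ x : ℝ) : ℂ))) *
        Complex.exp (Complex.I * ((dotp n ξ w : ℝ) : ℂ)) =
      (((2 * Real.pi) ^ n : ℝ) : ℂ) * A w := by
  set B : Cfg n → ℂ := fun ξ =>
    ∫ x, A x * Complex.exp (Complex.I * ((-dotp n ξ x : ℝ) : ℂ)) with hBdef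
  have hmp := PiLp.volume_preserving_ofLp (Fin n)
  have hme : MeasurableEmbedding (WithLp.ofLp : EuclideanSpace ℝ (Fin n) → Cfg n) :=
    (PiLp.continuousLinearEquiv 2 ℝ fun _ : Fin n => ℝ).toHomeomorph.measurableEmbedding
  have hinner (v u : EuclideanSpace ℝ (Fin n)) : inner ℝ v u = dotp n v.ofLp u.ofLp := by
    simp only [PiLp.inner_apply, dotp]
    exact Finset.sum_congr rfl fun i _ => mul_comm _ _
  have hF (v : EuclideanSpace ℝ (Fin n)) :
      𝓕 (fun u : EuclideanSpace ℝ (Fin n) => A u.ofLp) v = B ((2 * Real.pi) • v.ofLp) := by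
    rw [Real.fourier_eq', hBdef]
    dsimp only
    rw [← hmp.integral_comp hme]
    congr 1
    ext u
    rw [hinner, smul_eq_mul, mul_comm, mul_comm Complex.I, dotp_comm n (_ • _), dotp_smul]
    ring_nf
  have hBs : Integrable fun ξ : Cfg n => B ((2 * Real.pi) • ξ) :=
    (integrable_comp_smul_iff volume B (by positivity)).2 hB
  have hinv := Continuous.fourierInv_fourier_eq
    (f := fun u : EuclideanSpace ℝ (Fin n) => A u.ofLp)
    (hc.comp (PiLp.continuous_ofLp 2 _)) (hmp.integrable_comp_of_integrable hA)
    (by rw [funext hF]; exact hmp.integrable_comp_of_integrable hBs)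
  have hw := congrFun hinv (WithLp.toLp 2 w)
  rw [Real.fourierInv_eq'] at hw
  simp only [hF, hinner, smul_eq_mul] at hw
  have hcomp := hmp.integral_comp hme fun ξ : Cfg n =>
    Complex.exp (((2 * Real.pi * dotp n ξ w : ℝ) : ℂ) * Complex.I) * B ((2 * Real.pi) • ξ)
  rw [hcomp] at hw
  have hscale := Measure.integral_comp_smul (volume : Measure (Cfg n))
    (fun ξ => B ξ * Complex.exp (Complex.I * ((dotp n ξ w : ℝ) : ℂ))) (2 * Real.pi)
  rw [Module.finrank_fin_fun, abs_of_pos (by positivity)] at hscale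
  have hpi : (((2 * Real.pi) ^ n : ℝ) : ℂ) ≠ 0 := by
    exact_mod_cast (by positivity : ((2 * Real.pi) ^ n : ℝ) ≠ 0)
  rw [← hw, eq_comm, ← eq_inv_mul_iff_mul_eq₀ hpi, ← Complex.ofReal_inv,
    ← Complex.real_smul, ← hscale]
  congr 1
  ext ξ
  rw [dotp_comm n (_ • _), dotp_smul, dotp_comm n w, mul_comm, mul_comm Complex.I]

lemma continuous_partial_integral {E F : Type*} [NormedAddCommGroup E] [NormedSpace ℝ E]
    [NormedAddCommGroup F] [NormedSpace ℝ F] [FiniteDimensional ℝ F] [MeasurableSpace F]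
    [BorelSpace F] (μ : Measure F) [μ.IsAddHaarMeasure] (a : SchwartzMap (E × F) ℂ)
    {e : F → ℂ} (he : Continuous e) (hb : ∀ y, ‖e y‖ ≤ 1) :
    Continuous fun x => ∫ y, a (x, y) * e y ∂μ := by
  set N := Module.finrank ℝ F + 1
  set C : ℝ := 2 ^ N * ((Finset.Iic (N, 0)).sup fun m => SchwartzMap.seminorm ℝ m.1 m.2) a
  refine continuous_of_dominated (bound := fun y => C * (1 + ‖y‖) ^ (-(N : ℝ))) (fun x => ?_)
    (fun x => .of_forall fun y => ?_) (.const_mul (integrable_one_add_norm (by simp [N])) _)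
    (.of_forall fun y => by fun_prop)
  · exact Continuous.aestronglyMeasurable (by fun_prop)
  · have h := SchwartzMap.one_add_le_sup_seminorm_apply (𝕜 := ℝ) (m := (N, 0)) le_rfl le_rfl a
      (x, y)
    rw [norm_iteratedFDeriv_zero] at h
    have hy : ‖y‖ ≤ ‖(x, y)‖ := norm_snd_le (x, y)
    have hpos : 0 < (1 + ‖y‖) ^ N := by positivity
    rw [Real.rpow_neg (by positivity), Real.rpow_natCast, ← div_eq_mul_inv, le_div_iff₀ hpos,
      norm_mul]
    calc ‖a (x, y)‖ * ‖e y‖ * (1 + ‖y‖) ^ N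
        ≤ ‖a (x, y)‖ * 1 * (1 + ‖(x, y)‖) ^ N := by gcongr; exact hb y
      _ ≤ C := by rw [mul_one, mul_comm]; exact h

/-- The partial Fourier transform of a symbol in its momentum variable. -/
def momentumFourier (n : ℕ) (a : Phase n → ℂ) (x₀ x : Cfg n) : ℂ :=
  ∫ ξ : Cfg n, a (x, ξ) * Complex.exp (Complex.I * ((dotp n x₀ ξ : ℝ) : ℂ))

lemma integrable_mul_exp_dotp (n : ℕ) (a : SchwartzMap (Phase n) ℂ) (f : Phase n → ℝ)
    (hf : Continuous f) :
    Integrable fun z : Phase n => a z * Complex.exp (Complex.I * ((f z : ℝ) : ℂ)) :=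
  a.integrable.mul_bdd (c := 1) (Continuous.aestronglyMeasurable (by fun_prop))
    (.of_forall fun z => (norm_exp_I_mul _).le)

lemma continuous_momentumFourier (n : ℕ) (a : SchwartzMap (Phase n) ℂ) (x₀ : Cfg n) :
    Continuous (momentumFourier n a x₀) := by
  have := continuous_dotp (n := n) (continuous_const (y := x₀)) continuous_id
  exact continuous_partial_integral volume a
    (e := fun ξ => Complex.exp (Complex.I * ((dotp n x₀ ξ : ℝ) : ℂ)))
    (by fun_prop) fun ξ => (norm_exp_I_mul _).le

lemma integrable_momentumFourier (n : ℕ) (a : SchwartzMap (Phase n) ℂ) (x₀ : Cfg n) :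
    Integrable (momentumFourier n a x₀) :=
  (integrable_mul_exp_dotp n a (fun z => dotp n x₀ z.2)
    (continuous_dotp continuous_const continuous_snd)).integral_prod_left

lemma Fsig_eq_integral_momentumFourier (n : ℕ) (a : SchwartzMap (Phase n) ℂ) (x₀ ξ₀ : Cfg n) :
    Fsig n a (x₀, ξ₀) = (((2 * Real.pi) ^ n : ℝ) : ℂ)⁻¹ *
      ∫ x, momentumFourier n a x₀ x * Complex.exp (Complex.I * ((-dotp n ξ₀ x : ℝ) : ℂ)) := by
  have hc : Continuous fun z : Phase n => dotp n x₀ z.2 - dotp n ξ₀ z.1 :=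
    (continuous_dotp continuous_const continuous_snd).sub
      (continuous_dotp continuous_const continuous_fst)
  rw [Fsig, Measure.volume_eq_prod, integral_prod _ (integrable_mul_exp_dotp n a _ hc)]
  congr 2
  ext x
  rw [momentumFourier, ← integral_mul_const]
  congr 1
  ext ξ
  rw [mul_assoc, ← Complex.exp_add]
  congr 2
  push_cast
  ring

lemma integral_Fsig_mul_exp (n : ℕ) (a : SchwartzMap (Phase n) ℂ) {x₀ : Cfg n}
    (h : Integrable fun ξ₀ : Cfg n => Fsig n a (x₀, ξ₀)) (w : Cfg n) :
    ∫ ξ₀ : Cfg n, Fsig n a (x₀, ξ₀) * Complex.exp (Complex.I * ((dotp n ξ₀ w : ℝ) : ℂ)) =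
      momentumFourier n a x₀ w := by
  have hpi : (((2 * Real.pi) ^ n : ℝ) : ℂ) ≠ 0 := by
    exact_mod_cast (by positivity : ((2 * Real.pi) ^ n : ℝ) ≠ 0)
  simp only [Fsig_eq_integral_momentumFourier] at h ⊢
  rw [integrable_const_mul_iff (inv_ne_zero hpi).isUnit] at h
  simp only [mul_assoc]
  rw [integral_const_mul, fourier_inversion_dotp n (continuous_momentumFourier n a x₀)
    (integrable_momentumFourier n a x₀) h, inv_mul_cancel_left₀ hpi]

/-- The phase-space Weyl operator with Schwartz symbol a, applied to Schwartz Ψ, acts as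
the standard Weyl operator in the x-variable and the identity in the p-variable:
(2π)^{-n} ∫ F_σa(x₀,ξ₀) e^{i(ξ₀·x − ξ₀·x₀/2)} Ψ(x−x₀,p) dx₀dξ₀
  = (2π)^{-n} ∫∫ e^{iξ·(x−y)} a((x+y)/2, ξ) Ψ(y,p) dξ dy. -/
theorem phase_space_Weyl_eq_kernel_form (n : ℕ)
    (a : SchwartzMap (Phase n) ℂ) (Ψ : SchwartzMap (Phase n) ℂ) :
    ∀ x p : Cfg n,
      (((2 * Real.pi) ^ n : ℝ) : ℂ)⁻¹ *
        ∫ z₀ : Phase n, Fsig n (⇑a) z₀ *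
          Complex.exp (Complex.I * ((dotp n z₀.2 x - dotp n z₀.2 z₀.1 / 2 : ℝ) : ℂ)) *
          Ψ (x - z₀.1, p)
      = (((2 * Real.pi) ^ n : ℝ) : ℂ)⁻¹ *
        ∫ y : Cfg n, ∫ ξ : Cfg n,
          Complex.exp (Complex.I * ((dotp n ξ (x - y) : ℝ) : ℂ)) *
            a ((1 / 2 : ℝ) • (x + y), ξ) * Ψ (y, p) := by
  intro x p
  congr 1
  have hc : Continuous fun z₀ : Phase n => dotp n z₀.2 x - dotp n z₀.2 z₀.1 / 2 :=
    (continuous_dotp continuous_snd continuous_const).sub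
      ((continuous_dotp continuous_snd continuous_fst).div_const 2)
  have hint : Integrable fun z₀ : Phase n => Fsig n a z₀ *
      Complex.exp (Complex.I * ((dotp n z₀.2 x - dotp n z₀.2 z₀.1 / 2 : ℝ) : ℂ)) *
      Ψ (x - z₀.1, p) :=
    ((integrable_Fsig n a).mul_bdd (c := 1) (Continuous.aestronglyMeasurable (by fun_prop))
      (.of_forall fun z => (norm_exp_I_mul _).le)).mul_bdd
        (c := SchwartzMap.seminorm ℝ 0 0 Ψ) (Continuous.aestronglyMeasurable (by fun_prop))
        (.of_forall fun z => SchwartzMap.norm_le_seminorm ℝ Ψ _)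
  rw [Measure.volume_eq_prod, integral_prod _ hint]
  conv_rhs => rw [← integral_sub_left_eq_self _ _ x]
  refine integral_congr_ae ?_
  filter_upwards [(integrable_Fsig n a).prod_right_ae] with x₀ hx₀
  have hw (ξ₀ : Cfg n) :
      dotp n ξ₀ x - dotp n ξ₀ x₀ / 2 = dotp n ξ₀ ((1 / 2 : ℝ) • (x + (x - x₀))) := by
    have : (1 / 2 : ℝ) • (x + (x - x₀)) = x - (1 / 2 : ℝ) • x₀ := by module
    rw [this, dotp_sub, dotp_smul]
    ring
  simp only [hw]
  rw [integral_mul_const, integral_Fsig_mul_exp n a hx₀, momentumFourier, ← integral_mul_const]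
  congr 1
  ext ξ
  rw [sub_sub_cancel x x₀, dotp_comm n x₀, mul_comm (Complex.exp _)]
end
end

section
/- Let U := U_D(−ln√2) ∘ U_R(−π/4) on L²(ℝ²ⁿ). Then for every Ψ ∈ 𝒮(ℝ²ⁿ) and all (x,p): U Ψ(x,p) = (2π)^{-n/2} ∫_{ℝⁿ} e^{iξ_p·p} Ψ̂(x − ξ_p/2, x + ξ_p/2) dξ_p, where Ψ̂(x, ξ_p) = (2π)^{-n/2} ∫_{ℝⁿ} e^{-iξ_p·p} Ψ(x,p) dp is the partial Fourier transform of Ψ in the p-variable. -/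
open MeasureTheory Complex ComplexConjugate ENNReal

noncomputable section

/-- Partial Fourier transform in the p-variable:
ℱ_p[Ψ](x, ξ_p) = (2π)^{-n/2} ∫ e^{-iξ_p·p} Ψ(x,p) dp. -/
def Fp (n : ℕ) (Ψ : Phase n → ℂ) : Phase n → ℂ :=
  fun w => ((Real.sqrt ((2 * Real.pi) ^ n) : ℝ) : ℂ)⁻¹ *
    ∫ p : Cfg n, Complex.exp (-(Complex.I * ((dotp n w.2 p : ℝ) : ℂ))) * Ψ (w.1, p)

/-- Inverse partial Fourier transform in the p-variable. -/
def FpInv (n : ℕ) (Φ : Phase n → ℂ) : Phase n → ℂ :=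
  fun zp => ((Real.sqrt ((2 * Real.pi) ^ n) : ℝ) : ℂ)⁻¹ *
    ∫ ξ : Cfg n, Complex.exp (Complex.I * ((dotp n ξ zp.2 : ℝ) : ℂ)) * Φ (zp.1, ξ)

/-- The dilation operators U_D(s)Ψ(x,p) = e^{-ns} Ψ(e^{-s}x, e^{-s}p). -/
def UD (n : ℕ) (s : ℝ) (Ψ : Phase n → ℂ) : Phase n → ℂ :=
  fun zp => (Real.exp (-(n : ℝ) * s) : ℂ) *
    Ψ (Real.exp (-s) • zp.1, Real.exp (-s) • zp.2)

/-- The rotation operators U_R(θ). -/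
def UR (n : ℕ) (θ : ℝ) (Ψ : Phase n → ℂ) : Phase n → ℂ :=
  FpInv n (fun w => Fp n Ψ
    (Real.cos θ • w.1 + Real.sin θ • w.2, (-Real.sin θ) • w.1 + Real.cos θ • w.2))

/-- Explicit form of U = U_D(−ln√2) ∘ U_R(−π/4): for Schwartz Ψ,
UΨ(x,p) = (2π)^{-n/2} ∫ e^{iξ_p·p} Ψ̂(x − ξ_p/2, x + ξ_p/2) dξ_p. -/
theorem U_explicit_form (n : ℕ) (Ψ : SchwartzMap (Phase n) ℂ) :
    ∀ x p : Cfg n,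
      UD n (-Real.log (Real.sqrt 2)) (UR n (-(Real.pi / 4)) (⇑Ψ)) (x, p)
        = ((Real.sqrt ((2 * Real.pi) ^ n) : ℝ) : ℂ)⁻¹ *
          ∫ ξ : Cfg n, Complex.exp (Complex.I * ((dotp n ξ p : ℝ) : ℂ)) *
            Fp n (⇑Ψ) (x - (1 / 2 : ℝ) • ξ, x + (1 / 2 : ℝ) • ξ) := by
  intro x p
  have h2 : (0 : ℝ) < Real.sqrt 2 := Real.sqrt_pos.mpr two_pos
  have hsq : Real.sqrt 2 * Real.sqrt 2 = 2 := Real.mul_self_sqrt zero_le_two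
  have hexp : Real.exp (-(n : ℝ) * -Real.log (Real.sqrt 2)) = Real.sqrt 2 ^ n := by
    rw [neg_mul_neg, Real.exp_nat_mul, Real.exp_log h2]
  have hscale := Measure.integral_comp_smul (volume : Measure (Cfg n))
    (fun ξ : Cfg n => Complex.exp (Complex.I * ((dotp n ξ p : ℝ) : ℂ)) *
      Fp n (⇑Ψ) (x - (1 / 2 : ℝ) • ξ, x + (1 / 2 : ℝ) • ξ)) (Real.sqrt 2)
  rw [Module.finrank_fin_fun, abs_of_pos (by positivity), Complex.real_smul] at hscale
  have hint : ∀ ξ : Cfg n,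
      Complex.exp (Complex.I * ((dotp n ξ (Real.sqrt 2 • p) : ℝ) : ℂ)) *
        Fp n (⇑Ψ) (Real.cos (-(Real.pi / 4)) • Real.sqrt 2 • x + Real.sin (-(Real.pi / 4)) • ξ,
          (-Real.sin (-(Real.pi / 4))) • Real.sqrt 2 • x + Real.cos (-(Real.pi / 4)) • ξ) =
      Complex.exp (Complex.I * ((dotp n (Real.sqrt 2 • ξ) p : ℝ) : ℂ)) *
        Fp n (⇑Ψ) (x - (1 / 2 : ℝ) • Real.sqrt 2 • ξ, x + (1 / 2 : ℝ) • Real.sqrt 2 • ξ) := by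
    intro ξ
    have hdot : dotp n ξ (Real.sqrt 2 • p) = dotp n (Real.sqrt 2 • ξ) p :=
      Finset.sum_congr rfl fun i _ => by simp only [Pi.smul_apply, smul_eq_mul]; ring
    rw [hdot, Real.cos_neg, Real.sin_neg, Real.cos_pi_div_four, Real.sin_pi_div_four]
    congr 3 <;> ext i <;>
      simp only [Pi.add_apply, Pi.sub_apply, Pi.smul_apply, smul_eq_mul] <;>
      linear_combination (x i / 2) * hsq
  simp only [UD, UR, FpInv, neg_neg, Real.exp_log h2, hexp]
  rw [integral_congr_ae (Filter.Eventually.of_forall hint), hscale]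
  have hne : ((Real.sqrt 2 : ℝ) : ℂ) ≠ 0 := Complex.ofReal_ne_zero.mpr h2.ne'
  push_cast
  rw [mul_left_comm, mul_inv_cancel_left₀ (pow_ne_zero n hne)]
end
end

section
/- Let ψ, χ ∈ 𝒮(ℝⁿ) and set Ψ(x,p) = ψ(x)·conj(χ̂(p)), where χ̂ = ℱχ is the Fourier transform of χ. Let U be the unitary operator on L²(ℝ²ⁿ) acting on Schwartz functions by UΦ(x,p) = (2π)^{-n/2} ∫ e^{iξ·p} ℱ_pΦ(x − ξ/2, x + ξ/2) dξ. Then U Ψ(x,p) = (2π)^{-n/2} ∫_{ℝⁿ} e^{ip·ξ} ψ(x − ξ/2)·conj(χ(x + ξ/2)) dξ; that is, UΨ equals (2π)^{n/2} times the cross-Wigner function W(ψ,χ)(x,p) = (2π)^{-n} ∫ e^{-ip·y} ψ(x + y/2)·conj(χ(x − y/2)) dy. -/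
open MeasureTheory Complex ComplexConjugate ENNReal

noncomputable section

/-- The operator U = U_D(−ln√2) ∘ U_R(−π/4), acting on Schwartz functions by
UΦ(x,p) = (2π)^{-n/2} ∫ e^{iξ·p} ℱ_pΦ(x − ξ/2, x + ξ/2) dξ. -/
def Uact (n : ℕ) (Φ : Phase n → ℂ) : Phase n → ℂ :=
  fun zp => ((Real.sqrt ((2 * Real.pi) ^ n) : ℝ) : ℂ)⁻¹ *
    ∫ ξ : Cfg n, Complex.exp (Complex.I * ((dotp n ξ zp.2 : ℝ) : ℂ)) *
      Fp n Φ (zp.1 - (1 / 2 : ℝ) • ξ, zp.1 + (1 / 2 : ℝ) • ξ)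

/-- The Fourier transform ℱφ(p) = (2π)^{-n/2} ∫ e^{-ix·p} φ(x) dx. -/
def Four (n : ℕ) (φ : Cfg n → ℂ) : Cfg n → ℂ :=
  fun p => ((Real.sqrt ((2 * Real.pi) ^ n) : ℝ) : ℂ)⁻¹ *
    ∫ x : Cfg n, Complex.exp (-(Complex.I * ((dotp n x p : ℝ) : ℂ))) * φ x

/-- The Fourier transform `Four` in terms of Mathlib's Fourier transform on Euclidean space. -/
lemma Four_two_pi_smul (n : ℕ) (φ : Cfg n → ℂ) (v : EuclideanSpace ℝ (Fin n)) :
    Four n φ ((2 * Real.pi) • WithLp.ofLp v) =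
      ((Real.sqrt ((2 * Real.pi) ^ n) : ℝ) : ℂ)⁻¹ *
        FourierTransform.fourier (fun x : EuclideanSpace ℝ (Fin n) => φ (WithLp.ofLp x)) v := by
  rw [Real.fourier_eq', Four]
  congr 1
  rw [← (PiLp.volume_preserving_toLp (Fin n)).integral_comp
    (MeasurableEquiv.toLp 2 (Fin n → ℝ)).measurableEmbedding]
  refine integral_congr_ae (Filter.Eventually.of_forall fun x => ?_)
  simp only [smul_eq_mul]
  congr 2
  have h : dotp n x ((2 * Real.pi) • WithLp.ofLp v) =
      2 * Real.pi * inner ℝ (WithLp.toLp 2 x) v := by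
    simp only [dotp, PiLp.inner_apply, Finset.mul_sum, Pi.smul_apply, smul_eq_mul]
    refine Finset.sum_congr rfl fun i _ => ?_
    simp
    ring
  rw [h]
  push_cast
  ring

/-- Fourier inversion for Schwartz functions in the symmetric normalization. -/
lemma Four_inversion (n : ℕ) (φ : SchwartzMap (Cfg n) ℂ) (b : Cfg n) :
    ((Real.sqrt ((2 * Real.pi) ^ n) : ℝ) : ℂ)⁻¹ *
      ∫ p : Cfg n, Complex.exp (Complex.I * ((dotp n b p : ℝ) : ℂ)) * Four n (⇑φ) p = φ b := by
  have hpi : (0 : ℝ) < (2 * Real.pi) ^ n := by positivity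
  let f : SchwartzMap (EuclideanSpace ℝ (Fin n)) ℂ :=
    SchwartzMap.compCLMOfContinuousLinearEquiv ℂ (EuclideanSpace.equiv (Fin n) ℝ) φ
  have hcoe : (⇑f : EuclideanSpace ℝ (Fin n) → ℂ) = fun x => φ (WithLp.ofLp x) := rfl
  have hinv : FourierTransformInv.fourierInv (FourierTransform.fourier f) (WithLp.toLp 2 b) =
      φ b := by
    rw [FourierPair.fourierInv_fourier_eq f, hcoe]
  rw [SchwartzMap.fourierInv_coe, SchwartzMap.fourier_coe, Real.fourierInv_eq', hcoe] at hinv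
  have hscale := Measure.integral_comp_smul_of_nonneg (volume : Measure (Cfg n))
    (fun p => Complex.exp (Complex.I * ((dotp n b p : ℝ) : ℂ)) * Four n (⇑φ) p)
    (2 * Real.pi) (hR := by positivity)
  rw [Module.finrank_fin_fun, eq_inv_smul_iff₀ hpi.ne'] at hscale
  rw [← hscale, ← hinv, ← (PiLp.volume_preserving_toLp (Fin n)).integral_comp
    (MeasurableEquiv.toLp 2 (Fin n → ℝ)).measurableEmbedding, Complex.real_smul,
    ← integral_const_mul, ← integral_const_mul]
  refine integral_congr_ae (Filter.Eventually.of_forall fun p => ?_)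
  have hF := Four_two_pi_smul n φ (WithLp.toLp 2 p)
  have h : dotp n b ((2 * Real.pi) • p) =
      2 * Real.pi * inner ℝ (WithLp.toLp 2 p) (WithLp.toLp 2 b) := by
    simp only [dotp, PiLp.inner_apply, Finset.mul_sum, Pi.smul_apply, smul_eq_mul]
    refine Finset.sum_congr rfl fun i _ => ?_
    simp
    ring
  have hsq : ((Real.sqrt ((2 * Real.pi) ^ n) : ℝ) : ℂ) * ((Real.sqrt ((2 * Real.pi) ^ n) : ℝ) : ℂ)
      = (((2 * Real.pi) ^ n : ℝ) : ℂ) := by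
    rw [← Complex.ofReal_mul, Real.mul_self_sqrt hpi.le]
  have hne : ((Real.sqrt ((2 * Real.pi) ^ n) : ℝ) : ℂ) ≠ 0 :=
    Complex.ofReal_ne_zero.2 (Real.sqrt_pos.2 hpi).ne'
  simp only [smul_eq_mul] at hF ⊢
  rw [hF, h, ← hsq, mul_comm Complex.I]
  field_simp

/-- The partial Fourier transform turns `ψ ⊗ conj (ℱχ)` into `ψ ⊗ conj χ`. -/
lemma Fp_tensor_conj_Four (n : ℕ) (ψ : Cfg n → ℂ) (χ : SchwartzMap (Cfg n) ℂ) (a b : Cfg n) :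
    Fp n (fun zp : Phase n => ψ zp.1 * conj (Four n (⇑χ) zp.2)) (a, b) = ψ a * conj (χ b) := by
  rw [← Four_inversion n χ b, Fp, map_mul, ← integral_conj, map_inv₀, Complex.conj_ofReal,
    mul_left_comm, ← integral_const_mul (ψ a)]
  congr 1
  refine integral_congr_ae (Filter.Eventually.of_forall fun p => ?_)
  simp only [map_mul, ← Complex.exp_conj, Complex.conj_I, Complex.conj_ofReal, neg_mul]
  ring

/-- For Ψ = ψ ⊗ (ℱχ)*, UΨ is (2π)^{n/2} times the cross-Wigner function W(ψ, χ):
UΨ(x,p) = (2π)^{-n/2} ∫ e^{ip·ξ} ψ(x − ξ/2) conj(χ(x + ξ/2)) dξ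
        = (2π)^{n/2} · (2π)^{-n} ∫ e^{-ip·y} ψ(x + y/2) conj(χ(x − y/2)) dy. -/
theorem U_of_tensor_is_cross_Wigner (n : ℕ) (ψ χ : SchwartzMap (Cfg n) ℂ) :
    ∀ x p : Cfg n,
      Uact n (fun zp : Phase n => ψ zp.1 * conj (Four n (⇑χ) zp.2)) (x, p)
        = ((Real.sqrt ((2 * Real.pi) ^ n) : ℝ) : ℂ)⁻¹ *
          ∫ ξ : Cfg n, Complex.exp (Complex.I * ((dotp n p ξ : ℝ) : ℂ)) *
            (ψ (x - (1 / 2 : ℝ) • ξ) * conj (χ (x + (1 / 2 : ℝ) • ξ)))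
      ∧
      Uact n (fun zp : Phase n => ψ zp.1 * conj (Four n (⇑χ) zp.2)) (x, p)
        = ((Real.sqrt ((2 * Real.pi) ^ n) : ℝ) : ℂ) *
          ((((2 * Real.pi) ^ n : ℝ) : ℂ)⁻¹ *
            ∫ y : Cfg n, Complex.exp (-(Complex.I * ((dotp n p y : ℝ) : ℂ))) *
              (ψ (x + (1 / 2 : ℝ) • y) * conj (χ (x - (1 / 2 : ℝ) • y)))) := by
  intro x p
  have hdot : ∀ a b : Cfg n, dotp n a b = dotp n b a := fun a b => by
    simp only [dotp, mul_comm]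
  have hU : Uact n (fun zp : Phase n => ψ zp.1 * conj (Four n (⇑χ) zp.2)) (x, p)
        = ((Real.sqrt ((2 * Real.pi) ^ n) : ℝ) : ℂ)⁻¹ *
          ∫ ξ : Cfg n, Complex.exp (Complex.I * ((dotp n p ξ : ℝ) : ℂ)) *
            (ψ (x - (1 / 2 : ℝ) • ξ) * conj (χ (x + (1 / 2 : ℝ) • ξ))) := by
    simp only [Uact, Fp_tensor_conj_Four, hdot p]
  refine ⟨hU, ?_⟩
  have hpi : (0 : ℝ) < (2 * Real.pi) ^ n := by positivity
  have hconst : ((Real.sqrt ((2 * Real.pi) ^ n) : ℝ) : ℂ)⁻¹ =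
      ((Real.sqrt ((2 * Real.pi) ^ n) : ℝ) : ℂ) * (((2 * Real.pi) ^ n : ℝ) : ℂ)⁻¹ := by
    rw [← Complex.ofReal_inv, ← Complex.ofReal_inv, ← Complex.ofReal_mul, ← div_eq_mul_inv,
      Real.sqrt_div_self]
  rw [hU, ← mul_assoc, ← hconst, ← integral_neg_eq_self]
  have hneg : ∀ y : Cfg n, dotp n p (-y) = -dotp n p y := fun y => by simp [dotp]
  simp only [hneg, smul_neg, sub_neg_eq_add, ← sub_eq_add_neg, Complex.ofReal_neg, mul_neg]
end
end
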